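/- Every stably finite separative cone admits a unitary embedding into a normally divisible stably finite separative refinement cone, and also a strongly unitary embedding into a stably finite separative refinement cone. -/

import Mathlib

universe u

/-- Conical commutative monoid ("cone"): `x + y = 0` implies `x = y = 0`. -/
def IsConical (M : Type u) [AddCommMonoid M] : Prop :=
  ∀ x y : M, x + y = 0 → x = 0 ∧ y = 0

/-- Algebraic preorder: `x ≤ y` iff `∃ z, x + z = y`. -/
def AlgLE {M : Type u} [AddCommMonoid M] (x y : M) : Prop :=
  ∃ z : M, x + z = y

/-- Refinement monoid. -/
def IsRefinementMonoid (M : Type u) [AddCommMonoid M] : Prop :=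
  ∀ a₀ a₁ b₀ b₁ : M, a₀ + a₁ = b₀ + b₁ →
    ∃ c₀₀ c₀₁ c₁₀ c₁₁ : M,
      a₀ = c₀₀ + c₀₁ ∧ a₁ = c₁₀ + c₁₁ ∧ b₀ = c₀₀ + c₁₀ ∧ b₁ = c₀₁ + c₁₁

/-- Unitary homomorphism: injective, cofinal image, and `f a₀ + b = f a₁ → b ∈ range f`. -/
def IsUnitary {A : Type u} {B : Type u} [AddCommMonoid A] [AddCommMonoid B]
    (f : A →+ B) : Prop :=
  Function.Injective f ∧
  (∀ b : B, ∃ a : A, AlgLE b (f a)) ∧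
  (∀ a₀ a₁ : A, ∀ b : B, f a₀ + b = f a₁ → b ∈ Set.range f)

/-- Strongly unitary homomorphism. -/
def IsStronglyUnitary {A : Type u} {B : Type u} [AddCommMonoid A] [AddCommMonoid B]
    (f : A →+ B) : Prop :=
  IsUnitary f ∧ ∀ m : ℕ, 0 < m → ∀ b : B, m • b ∈ Set.range f → b ∈ Set.range f

/-- Normally divisible commutative monoid. -/
def IsNormallyDivisible (M : Type u) [AddCommMonoid M] : Prop :=
  ∀ p : ℕ, 0 < p → ∀ X : Finset M, ∀ a : M,
    ∃ u : M, p • u = a ∧ ∀ x ∈ X, ∀ y ∈ X, x + a = y + a → x + u = y + u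

/-- Order-embedding of commutative monoids (w.r.t. the algebraic preorders). -/
def IsOrderEmbeddingHom {A : Type u} {B : Type u} [AddCommMonoid A] [AddCommMonoid B]
    (f : A →+ B) : Prop :=
  Function.Injective f ∧ ∀ x y : A, AlgLE x y ↔ AlgLE (f x) (f y)

/-- Simple commutative monoid: every `u ≰ 0` is an order-unit. -/
def IsSimpleMonoid (M : Type u) [AddCommMonoid M] : Prop :=
  ∀ u : M, ¬ AlgLE u 0 → ∀ x : M, ∃ n : ℕ, 0 < n ∧ AlgLE x (n • u)

/-- Weak sum decomposition axiom (WSD). -/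
def WSD (M : Type u) [AddCommMonoid M] : Prop :=
  ∀ a₀ a₁ b c : M, a₀ + a₁ + c = b + c →
    ∃ x₀ x₁ : M, a₀ + c = x₀ + c ∧ a₁ + c = x₁ + c ∧ b = x₀ + x₁

/-- `a ∝ b` : `a ≤ n • b` for some positive integer `n`. -/
def Propto {M : Type u} [AddCommMonoid M] (a b : M) : Prop :=
  ∃ n : ℕ, 0 < n ∧ AlgLE a (n • b)

/-- `a ≍ b` : `a ∝ b` and `b ∝ a`. -/
def Asymp {M : Type u} [AddCommMonoid M] (a b : M) : Prop :=
  Propto a b ∧ Propto b a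

/-- Cancellative commutative monoid. -/
def IsCancellativeMonoid (M : Type u) [AddCommMonoid M] : Prop :=
  ∀ x y z : M, x + z = y + z → x = y

/-- Separative commutative monoid. -/
def IsSeparative (M : Type u) [AddCommMonoid M] : Prop :=
  ∀ x y : M, 2 • x = x + y → x + y = 2 • y → x = y

/-- Stably finite commutative monoid. -/
def IsStablyFinite (M : Type u) [AddCommMonoid M] : Prop :=
  ∀ x y : M, x + y = y → x = 0

/-- Quasi-divisible commutative monoid. -/
def IsQuasiDivisible (M : Type u) [AddCommMonoid M] : Prop :=
  ∀ x : M, ∃ u v : M, 2 • u + 3 • v = x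

/-- `ℙ`-torsion-free commutative monoid. -/
def PTorsionFree (P : Set ℕ) (M : Type u) [AddCommMonoid M] : Prop :=
  ∀ p ∈ P, ∀ x y : M, p • x = p • y → x = y

/-- `ℙ`-unperforated commutative monoid (w.r.t. the algebraic preorder). -/
def PUnperforated (P : Set ℕ) (M : Type u) [AddCommMonoid M] : Prop :=
  ∀ p ∈ P, ∀ x y : M, AlgLE (p • x) (p • y) → AlgLE x y

/-- A stably finite separative cone. -/
structure IsStablyFiniteSepCone (M : Type u) [AddCommMonoid M] : Prop where
  conical : IsConical M
  stablyFinite : IsStablyFinite M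
  separative : IsSeparative M

/-! ### Separative monoids -/

namespace IsSeparative

variable {M : Type u} [AddCommMonoid M]

theorem eq_of_nsmul_add_eq (h : IsSeparative M) {x y : M} {n : ℕ}
    (hx : n • x + x = n • x + y) (hy : n • y + x = n • y + y) : x = y := by
  induction n with
  | zero => simpa using hx
  | succ k ih =>
    rcases Nat.eq_zero_or_pos k with rfl | hk
    · simp only [zero_add, one_smul] at hx hy
      exact h x y (by rw [two_nsmul, hx]) (by rw [two_nsmul, ← hy, add_comm])
    · have key : ∀ z : M, (k + 1) • z + x = (k + 1) • z + y → k • z + x = k • z + y := by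
        intro z hz
        obtain ⟨l, rfl⟩ : ∃ l, k = l + 1 := ⟨k - 1, by omega⟩
        have e : ∀ p q : M, ((l + 1) • z + p) + ((l + 1) • z + q) =
            l • z + ((l + 1 + 1) • z + p) + q := by
          intro p q
          simp only [add_nsmul, one_nsmul]
          abel
        apply h
        · rw [two_nsmul, e, add_comm ((l + 1) • z + x), e, hz]
        · rw [two_nsmul, e, e, hz]
      exact ih (key x hx) (key y hy)

theorem add_right_cancel_of_le (h : IsSeparative M) {x y c : M} {m n : ℕ}
    (hx : AlgLE c (m • x)) (hy : AlgLE c (n • y)) (hc : x + c = y + c) : x = y := by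
  obtain ⟨d, hd⟩ := hx
  obtain ⟨e, he⟩ := hy
  have hx' : m • x + x = m • x + y := by
    rw [← hd, add_comm c d, add_assoc, add_assoc, add_comm c x, add_comm c y, hc]
  have hy' : n • y + x = n • y + y := by
    rw [← he, add_comm c e, add_assoc, add_assoc, add_comm c x, add_comm c y, hc]
  apply h.eq_of_nsmul_add_eq (n := m + n)
  · rw [add_nsmul, add_comm (m • x), add_assoc, add_assoc, hx']
  · rw [add_nsmul, add_assoc, add_assoc, hy']

end IsSeparative

/-- In a separative monoid, divisibility is automatically normal. -/
theorem IsSeparative.isNormallyDivisible {M : Type u} [AddCommMonoid M] (h : IsSeparative M)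
    (hd : ∀ p : ℕ, 0 < p → ∀ a : M, ∃ u, p • u = a) : IsNormallyDivisible M := by
  intro p hp X a
  obtain ⟨u, rfl⟩ := hd p hp a
  refine ⟨u, rfl, fun x _ y _ hxy => ?_⟩
  obtain ⟨k, rfl⟩ : ∃ k, p = k + 1 := ⟨p - 1, by omega⟩
  have hle : ∀ z : M, AlgLE (k • u) (k • (z + u)) := fun z => ⟨k • z, by
    rw [nsmul_add, add_comm]⟩
  refine h.add_right_cancel_of_le (hle x) (hle y) ?_
  rw [add_nsmul, one_nsmul] at hxy
  rw [add_assoc, add_assoc, add_comm u, hxy]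

/-! ### Characters with values in an extended circle -/

/-- The rational circle with an absorbing element adjoined. -/
abbrev ExtCircle : Type := WithTop (AddCircle (1 : ℚ))

namespace ExtCircle

theorem separative (x y : ExtCircle) (h₁ : 2 • x = x + y) (h₂ : x + y = 2 • y) : x = y := by
  rw [two_nsmul] at h₁ h₂
  induction x using WithTop.recTopCoe with
  | top => induction y using WithTop.recTopCoe with
    | top => rfl
    | coe y => exact absurd h₂ (by simp [← WithTop.coe_add])
  | coe x => induction y using WithTop.recTopCoe with
    | top => exact absurd h₁ (by simp [← WithTop.coe_add])
    | coe y =>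
      norm_cast at h₁ ⊢
      exact add_left_cancel h₁

theorem exists_nsmul_eq {p : ℕ} (hp : 0 < p) (a : ExtCircle) :
    ∃ u : ExtCircle, p • u = a ∧ (a = ⊤ → u = ⊤) := by
  induction a using WithTop.recTopCoe with
  | top =>
    refine ⟨⊤, ?_, fun _ => rfl⟩
    obtain ⟨k, rfl⟩ : ∃ k, p = k + 1 := ⟨p - 1, by omega⟩
    rw [add_nsmul, one_nsmul, WithTop.add_top]
  | coe a =>
    obtain ⟨r, rfl⟩ := QuotientAddGroup.mk_surjective a
    refine ⟨((r / p : ℚ) : AddCircle (1 : ℚ)), ?_, fun h => absurd h (WithTop.coe_ne_top)⟩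
    have : p • ((r / p : ℚ) : AddCircle (1 : ℚ)) = (r : AddCircle (1 : ℚ)) := by
      rw [← AddCircle.coe_nsmul, nsmul_eq_mul, mul_div_cancel₀ _ (by positivity)]
    exact congrArg WithTop.some this

/-- The extended circle is a refinement monoid, and if all data are `⊤` then the refinement
can be chosen with all entries `⊤`. -/
theorem exists_refinement (a₀ a₁ b₀ b₁ : ExtCircle) (h : a₀ + a₁ = b₀ + b₁) :
    ∃ c₀₀ c₀₁ c₁₀ c₁₁ : ExtCircle,
      c₀₀ + c₀₁ = a₀ ∧ c₁₀ + c₁₁ = a₁ ∧ c₀₀ + c₁₀ = b₀ ∧ c₀₁ + c₁₁ = b₁ ∧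
      (a₀ = ⊤ → a₁ = ⊤ → b₀ = ⊤ → b₁ = ⊤ → c₀₀ = ⊤ ∧ c₀₁ = ⊤ ∧ c₁₀ = ⊤ ∧ c₁₁ = ⊤) := by
  have sub : ∀ x y : AddCircle (1 : ℚ), (x : ExtCircle) + ((y - x : AddCircle (1 : ℚ))) = y := by
    intro x y
    rw [← WithTop.coe_add, add_sub_cancel]
  have sub' : ∀ x y : AddCircle (1 : ℚ), ((y - x : AddCircle (1 : ℚ)) : ExtCircle) + x = y := by
    intro x y
    rw [← WithTop.coe_add, sub_add_cancel]
  induction a₀ using WithTop.recTopCoe with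
  | top =>
    induction a₁ using WithTop.recTopCoe with
    | top =>
      induction b₀ using WithTop.recTopCoe with
      | top =>
        induction b₁ using WithTop.recTopCoe with
        | top => exact ⟨⊤, ⊤, ⊤, ⊤, by simp⟩
        | coe b₁ => exact ⟨⊤, 0, ⊤, b₁, by simp⟩
      | coe b₀ =>
        induction b₁ using WithTop.recTopCoe with
        | top => exact ⟨b₀, ⊤, 0, ⊤, by simp⟩
        | coe b₁ => exact absurd h (by simp [← WithTop.coe_add])
    | coe a₁ =>
      induction b₀ using WithTop.recTopCoe with
      | top =>
        induction b₁ using WithTop.recTopCoe with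
        | top => exact ⟨⊤, ⊤, 0, a₁, by simp⟩
        | coe b₁ => exact ⟨⊤, 0, (a₁ - b₁ : AddCircle (1 : ℚ)), b₁, by simp, sub' _ _, by simp,
            by simp, by simp⟩
      | coe b₀ =>
        induction b₁ using WithTop.recTopCoe with
        | top => exact ⟨0, ⊤, b₀, (a₁ - b₀ : AddCircle (1 : ℚ)), by simp, sub _ _, by simp,
            by simp, by simp⟩
        | coe b₁ => exact absurd h (by simp [← WithTop.coe_add])
  | coe a₀ =>
    induction a₁ using WithTop.recTopCoe with
    | top =>
      induction b₀ using WithTop.recTopCoe with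
      | top =>
        induction b₁ using WithTop.recTopCoe with
        | top => exact ⟨a₀, 0, ⊤, ⊤, by simp⟩
        | coe b₁ => exact ⟨(a₀ - b₁ : AddCircle (1 : ℚ)), b₁, ⊤, 0, sub' _ _, by simp, by simp,
            by simp, by simp⟩
      | coe b₀ =>
        induction b₁ using WithTop.recTopCoe with
        | top => exact ⟨b₀, (a₀ - b₀ : AddCircle (1 : ℚ)), 0, ⊤, sub _ _, by simp, by simp,
            by simp, by simp⟩
        | coe b₁ => exact absurd h (by simp [← WithTop.coe_add])
    | coe a₁ =>
      induction b₀ using WithTop.recTopCoe with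
      | top => exact absurd h (by simp [← WithTop.coe_add])
      | coe b₀ =>
        induction b₁ using WithTop.recTopCoe with
        | top => exact absurd h (by simp [← WithTop.coe_add])
        | coe b₁ =>
          norm_cast at h
          refine ⟨0, a₀, b₀, (a₁ - b₀ : AddCircle (1 : ℚ)), by simp, sub _ _, by simp, ?_,
            by simp⟩
          norm_cast
          rw [← add_sub_assoc, h, add_sub_cancel_left]

end ExtCircle

section Characters

variable {M : Type u} [AddCommMonoid M]

open scoped Classical in
/-- Extend a homomorphism defined on a face of a monoid by the value `⊤` outside the face. -/
noncomputable def faceExtend {A : Type*} [AddCommMonoid A] (F : AddSubmonoid M)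
    (hF : ∀ x y, x + y ∈ F → x ∈ F) (g : F →+ A) : M →+ WithTop A where
  toFun x := if h : x ∈ F then (g ⟨x, h⟩ : WithTop A) else ⊤
  map_zero' := by
    rw [dif_pos F.zero_mem]
    exact congrArg WithTop.some g.map_zero
  map_add' x y := by
    by_cases hx : x ∈ F
    · by_cases hy : y ∈ F
      · rw [dif_pos hx, dif_pos hy, dif_pos (F.add_mem hx hy), ← WithTop.coe_add, ← g.map_add]
        rfl
      · rw [dif_neg hy, dif_neg (fun h => hy (hF y x (by rwa [add_comm]))), WithTop.add_top]
    · rw [dif_neg hx, dif_neg (fun h => hx (hF x y h)), WithTop.top_add]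

theorem faceExtend_of_mem {A : Type*} [AddCommMonoid A] {F : AddSubmonoid M}
    (hF : ∀ x y, x + y ∈ F → x ∈ F) (g : F →+ A) {x : M} (hx : x ∈ F) :
    faceExtend F hF g x = (g ⟨x, hx⟩ : WithTop A) := dif_pos hx

theorem faceExtend_of_notMem {A : Type*} [AddCommMonoid A] {F : AddSubmonoid M}
    (hF : ∀ x y, x + y ∈ F → x ∈ F) (g : F →+ A) {x : M} (hx : x ∉ F) :
    faceExtend F hF g x = ⊤ := dif_neg hx

/-- The face generated by an element. -/
def faceOf (x : M) : AddSubmonoid M where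
  carrier := {z | ∃ n : ℕ, AlgLE z (n • x)}
  zero_mem' := ⟨0, 0, by simp⟩
  add_mem' := by
    rintro a b ⟨m, c, hc⟩ ⟨n, d, hd⟩
    exact ⟨m + n, c + d, by rw [add_nsmul, ← hc, ← hd]; abel⟩

theorem mem_faceOf_of_add_mem {x : M} (y z : M) (h : y + z ∈ faceOf x) : y ∈ faceOf x := by
  obtain ⟨n, c, hc⟩ := h
  exact ⟨n, z + c, by rw [← add_assoc, hc]⟩

theorem self_mem_faceOf (x : M) : x ∈ faceOf x := ⟨1, 0, by simp⟩

/-- Characters with values in the extended circle separate the points of a separative monoid. -/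
theorem IsSeparative.exists_character_ne (h : IsSeparative M) {x y : M} (hxy : x ≠ y) :
    ∃ φ : M →+ ExtCircle, φ x ≠ φ y := by
  have aux : ∀ a b : M, b ∉ faceOf a → ∃ φ : M →+ ExtCircle, φ a ≠ φ b := by
    intro a b hb
    refine ⟨faceExtend (faceOf a) mem_faceOf_of_add_mem 0, ?_⟩
    rw [faceExtend_of_mem _ _ (self_mem_faceOf a), faceExtend_of_notMem _ _ hb]
    exact WithTop.coe_ne_top
  by_cases hy : y ∈ faceOf x
  · by_cases hx : x ∈ faceOf y
    · let ι : faceOf x →+ Algebra.GrothendieckAddGroup (faceOf x) :=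
        (AddLocalization.addMonoidOf (⊤ : AddSubmonoid (faceOf x))).toAddMonoidHom
      have hne : ι ⟨x, self_mem_faceOf x⟩ - ι ⟨y, hy⟩ ≠ 0 := by
        intro h0
        obtain ⟨c, hc⟩ := (AddLocalization.addMonoidOf
          (⊤ : AddSubmonoid (faceOf x))).eq_iff_exists.1 (sub_eq_zero.1 h0)
        have hc' : (c : faceOf x).1 + x = (c : faceOf x).1 + y := congrArg Subtype.val hc
        obtain ⟨m, hm⟩ := (c : faceOf x).2
        obtain ⟨k, d, hd⟩ := hx
        obtain ⟨e, he⟩ := hm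
        refine hxy (h.add_right_cancel_of_le (m := m) (n := m * k) ⟨e, he⟩
          ⟨e + m • d, ?_⟩ (by rw [add_comm x, add_comm y, hc']))
        rw [← add_assoc, he, mul_nsmul', ← hd, nsmul_add]
      obtain ⟨c, hc⟩ := CharacterModule.exists_character_apply_ne_zero_of_ne_zero hne
      refine ⟨faceExtend (faceOf x) mem_faceOf_of_add_mem ((c : _ →+ AddCircle (1 : ℚ)).comp ι),
        fun he => hc ?_⟩
      rw [faceExtend_of_mem _ _ (self_mem_faceOf x), faceExtend_of_mem _ _ hy,
        WithTop.coe_inj] at he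
      rw [map_sub, sub_eq_zero]
      exact he
    · obtain ⟨φ, hφ⟩ := aux y x hx
      exact ⟨φ, hφ.symm⟩
  · exact aux x y hy

theorem IsConical.exists_character_eq_top (h : IsConical M) :
    ∃ χ : M →+ ExtCircle, ∀ m, χ m = ⊤ ∨ m = 0 := by
  refine ⟨faceExtend (⊥ : AddSubmonoid M) (fun x y hxy => (h x y hxy).1) 0, fun m => ?_⟩
  by_cases hm : m ∈ (⊥ : AddSubmonoid M)
  · exact Or.inr hm
  · exact Or.inl (faceExtend_of_notMem _ _ hm)

variable (M) in
/-- The bidual of a monoid with respect to the extended circle. -/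
abbrev Bidual : Type u := (M →+ ExtCircle) → ExtCircle

variable (M) in
/-- Evaluation of characters. -/
def bidualEval : M →+ Bidual M where
  toFun m φ := φ m
  map_zero' := funext fun φ => φ.map_zero
  map_add' x y := funext fun φ => φ.map_add x y

theorem IsSeparative.bidualEval_injective (h : IsSeparative M) :
    Function.Injective (bidualEval M) := by
  intro x y hxy
  by_contra hne
  obtain ⟨φ, hφ⟩ := h.exists_character_ne hne
  exact hφ (congrFun hxy φ)

end Characters

/-! ### Graded extensions -/

section GradedExtension

variable {M : Type u} [AddCommMonoid M]

/-- Given submonoids `S q` of `Bidual M × A` whose elements of degree zero lie in `M`, the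
monoid `M` has a unitary extension receiving all the `S q` simultaneously. -/
theorem exists_graded_extension (hM : IsStablyFiniteSepCone M) {Q : Type u} {A : Type}
    [AddCommGroup A] (S : Q → AddSubmonoid (Bidual M × A)) {χ : M →+ ExtCircle}
    (hχ : ∀ m, χ m = ⊤ ∨ m = 0)
    (hS₀ : ∀ q, ∀ s ∈ S q, s.2 = 0 → ∃ m, s.1 = bidualEval M m)
    (hSχ : ∀ q, ∀ s ∈ S q, s.1 χ = ⊤ ∨ s = 0)
    (hSc : ∀ q, ∀ s ∈ S q, ∃ s' ∈ S q, ∃ m, s + s' = (bidualEval M m, 0)) :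
    ∃ (N : Type u) (_ : AddCommMonoid N), IsStablyFiniteSepCone N ∧
      ∃ f : M →+ N, IsUnitary f ∧
        ((∀ m : ℕ, 0 < m → ∀ a : A, m • a = 0 → a = 0) → IsStronglyUnitary f) ∧
        ∃ g : ∀ q, S q →+ N, ∀ q (s : S q) m, s.1 = (bidualEval M m, 0) → g q s = f m := by
  classical
  let j : M →+ Bidual M × (Q → A) := (AddMonoidHom.inl _ _).comp (bidualEval M)
  have hj2 : ∀ m, (j m).2 = 0 := fun _ => rfl
  have hj : Function.Injective j := fun x y h =>
    hM.separative.bidualEval_injective (congrArg Prod.fst h)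
  let inc : ∀ q : Q, Bidual M × A →+ Bidual M × (Q → A) := fun q =>
    (AddMonoidHom.id _).prodMap (AddMonoidHom.single (fun _ => A) q)
  let N : AddSubmonoid (Bidual M × (Q → A)) :=
    AddSubmonoid.closure (Set.range j ∪ ⋃ q, inc q '' S q)
  have hjN : ∀ m, j m ∈ N := fun m => AddSubmonoid.subset_closure (Or.inl ⟨m, rfl⟩)
  have hincN : ∀ q, ∀ s ∈ S q, inc q s ∈ N := fun q s hs =>
    AddSubmonoid.subset_closure (Or.inr (Set.mem_iUnion.2 ⟨q, s, hs, rfl⟩))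
  have ind : ∀ P : Bidual M × (Q → A) → Prop, (∀ m, P (j m)) →
      (∀ q, ∀ s ∈ S q, P (inc q s)) → (∀ x ∈ N, ∀ y ∈ N, P x → P y → P (x + y)) →
      ∀ x ∈ N, P x := by
    intro P h1 h2 h3 x hx
    induction hx using AddSubmonoid.closure_induction with
    | mem x hx =>
      rcases hx with ⟨m, rfl⟩ | hx
      · exact h1 m
      · obtain ⟨q, s, hs, rfl⟩ := Set.mem_iUnion.1 hx
        exact h2 q s hs
    | zero => exact j.map_zero ▸ h1 0
    | add x y hx hy ihx ihy => exact h3 x hx y hy ihx ihy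
  have hNχ : ∀ x ∈ N, x.1 χ = ⊤ ∨ x = 0 := by
    apply ind
    · intro m
      rcases hχ m with h | rfl
      · exact Or.inl h
      · exact Or.inr j.map_zero
    · intro q s hs
      rcases hSχ q s hs with h | rfl
      · exact Or.inl h
      · exact Or.inr (inc q).map_zero
    · rintro x - y - (hx | rfl) (hy | rfl)
      · exact Or.inl (by rw [Prod.fst_add, Pi.add_apply, hx, WithTop.top_add])
      · exact Or.inl (by rw [add_zero, hx])
      · exact Or.inl (by rw [zero_add, hy])
      · exact Or.inr (add_zero 0)
  have hNc : ∀ x ∈ N, ∃ y ∈ N, ∃ m, x + y = j m := by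
    apply ind
    · exact fun m => ⟨0, N.zero_mem, m, add_zero _⟩
    · intro q s hs
      obtain ⟨s', hs', m, hm⟩ := hSc q s hs
      refine ⟨inc q s', hincN q s' hs', m, ?_⟩
      rw [← map_add, hm]
      exact Prod.ext rfl (Pi.single_zero q)
    · rintro x - y - ⟨x', hx', m, hm⟩ ⟨y', hy', n, hn⟩
      exact ⟨x' + y', N.add_mem hx' hy', m + n, by rw [map_add, ← hm, ← hn]; abel⟩
  have hN₀ : ∀ x ∈ N, x.2 = 0 → ∃ m, x = j m := by
    have key : ∀ x ∈ N, ∃ (m : M) (f : Q →₀ Bidual M × A), (∀ q, f q ∈ S q) ∧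
        x = j m + f.sum fun q s => inc q s := by
      apply ind
      · exact fun m => ⟨m, 0, fun q => (S q).zero_mem, by simp⟩
      · intro q s hs
        refine ⟨0, Finsupp.single q s, fun q' => ?_, by simp⟩
        by_cases hq : q = q'
        · subst hq; simpa using hs
        · rw [Finsupp.single_eq_of_ne (Ne.symm hq)]
          exact (S q').zero_mem
      · rintro x - y - ⟨m, f, hf, rfl⟩ ⟨n, g, hg, rfl⟩
        refine ⟨m + n, f + g, fun q => (S q).add_mem (hf q) (hg q), ?_⟩
        rw [Finsupp.sum_add_index' (fun q => (inc q).map_zero) (fun q => (inc q).map_add),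
          map_add]
        abel
    intro x hx hx0
    obtain ⟨m, f, hf, rfl⟩ := key x hx
    have hfq : ∀ q, (f q).2 = 0 := by
      intro q
      have h0 := congrFun hx0 q
      have hsum : (f.sum fun q s => inc q s).2 q = (f q).2 := by
        rw [Finsupp.sum, Prod.snd_sum, Finset.sum_apply, Finset.sum_eq_single q]
        · exact Pi.single_eq_same (M := fun _ => A) q (f q).2
        · exact fun q' _ hq' => Pi.single_eq_of_ne hq'.symm _
        · intro hq
          rw [Finsupp.notMem_support_iff.1 hq, map_zero]
          rfl
      rw [Prod.snd_add, hj2, zero_add, hsum] at h0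
      exact h0
    have hmem : j m + (f.sum fun q s => inc q s) ∈ AddMonoidHom.mrange j := by
      refine add_mem ⟨m, rfl⟩ (sum_mem fun q _ => ?_)
      obtain ⟨n, hn⟩ := hS₀ q _ (hf q) (hfq q)
      refine ⟨n, Prod.ext hn.symm ?_⟩
      have : (inc q (f q)).2 = Pi.single q (f q).2 := rfl
      rw [this, hfq q, Pi.single_zero, hj2]
    obtain ⟨n, hn⟩ := hmem
    exact ⟨n, hn.symm⟩
  let f : M →+ N := j.codRestrict N hjN
  have hfr : ∀ x : N, x.1.2 = 0 → x ∈ Set.range f := fun x hx => by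
    obtain ⟨m, hm⟩ := hN₀ x.1 x.2 hx
    exact ⟨m, Subtype.ext hm.symm⟩
  have hf : IsUnitary f := by
    refine ⟨fun x y h => hj (congrArg Subtype.val h), fun b => ?_, fun a₀ a₁ b hb => hfr b ?_⟩
    · obtain ⟨y, hy, m, hm⟩ := hNc b.1 b.2
      exact ⟨m, ⟨y, hy⟩, Subtype.ext hm⟩
    · have := congrArg (fun x : N => x.1.2) hb
      exact (zero_add b.1.2).symm.trans this
  refine ⟨N, inferInstance, ⟨?_, ?_, ?_⟩, f, hf, fun hA => ⟨hf, fun m hm b hb => hfr b ?_⟩,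
    fun q => ((inc q).comp (S q).subtype).codRestrict N fun s => hincN q s s.2, ?_⟩
  · intro x y hxy
    have h0 : x.1.1 χ + y.1.1 χ = 0 := congrArg (fun z : N => z.1.1 χ) hxy
    constructor
    · rcases hNχ x.1 x.2 with h | h
      · exact absurd h0 (by simp [h])
      · exact Subtype.ext h
    · rcases hNχ y.1 y.2 with h | h
      · exact absurd h0 (by simp [h])
      · exact Subtype.ext h
  · intro x y hxy
    have hx0 : x.1.2 = 0 := add_eq_right.1 (congrArg (fun z : N => z.1.2) hxy)
    obtain ⟨m, rfl⟩ := hfr x hx0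
    obtain ⟨n, z, hz⟩ := hf.2.1 y
    have h : f (m + n) = f n := by rw [map_add, ← hz, ← add_assoc, hxy]
    rw [hM.stablyFinite m n (hf.1 h), map_zero]
  · intro x y h₁ h₂
    refine Subtype.ext (Prod.ext (funext fun φ => ExtCircle.separative _ _ ?_ ?_) ?_)
    · exact congrArg (fun z : N => z.1.1 φ) h₁
    · exact congrArg (fun z : N => z.1.1 φ) h₂
    · have := congrArg (fun z : N => z.1.2) h₁
      rw [two_nsmul] at this
      exact add_left_cancel this
  · obtain ⟨a, ha⟩ := hb
    refine funext fun q => hA m hm _ ?_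
    exact (congrArg (fun z : N => z.1.2 q) ha).symm
  · intro q s m hs
    refine Subtype.ext ?_
    change inc q s.1 = j m
    rw [hs]
    exact Prod.ext rfl (Pi.single_zero q)

end GradedExtension

/-! ### Adjoining refinements and quotients -/

section OneStep

variable {M : Type u} [AddCommMonoid M]

theorem closure_eq_top_or_eq_zero {A : Type*} [AddCommMonoid A] {χ : M →+ ExtCircle}
    {G : Set (Bidual M × A)} (hG : ∀ s ∈ G, s.1 χ = ⊤) :
    ∀ s ∈ AddSubmonoid.closure G, s.1 χ = ⊤ ∨ s = 0 := by
  intro s hs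
  induction hs using AddSubmonoid.closure_induction with
  | mem s hs => exact Or.inl (hG s hs)
  | zero => exact Or.inr rfl
  | add x y _ _ hx hy =>
    rcases hx with hx | rfl
    · exact Or.inl (by rw [Prod.fst_add, Pi.add_apply, hx, WithTop.top_add])
    · rwa [zero_add]

theorem closure_exists_add_eq {A : Type*} [AddCommMonoid A] {G : Set (Bidual M × A)}
    (hG : ∀ s ∈ G, ∃ s' ∈ AddSubmonoid.closure G, ∃ m, s + s' = (bidualEval M m, 0)) :
    ∀ s ∈ AddSubmonoid.closure G, ∃ s' ∈ AddSubmonoid.closure G,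
      ∃ m, s + s' = (bidualEval M m, 0) := by
  intro s hs
  induction hs using AddSubmonoid.closure_induction with
  | mem s hs => exact hG s hs
  | zero => exact ⟨0, zero_mem _, 0, by simp [← Prod.zero_eq_mk]⟩
  | add x y _ _ hx hy =>
    obtain ⟨x', hx', m, hm⟩ := hx
    obtain ⟨y', hy', n, hn⟩ := hy
    exact ⟨x' + y', add_mem hx' hy', m + n, by
      rw [add_add_add_comm, hm, hn, Prod.mk_add_mk, map_add, add_zero]⟩

theorem exists_quotient_submonoid {χ : M →+ ExtCircle} {a : M} (ha : χ a = ⊤) {p : ℕ}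
    (hp : 0 < p) :
    ∃ S : AddSubmonoid (Bidual M × AddCircle (1 : ℚ)),
      (∀ s ∈ S, s.2 = 0 → ∃ m, s.1 = bidualEval M m) ∧
      (∀ s ∈ S, s.1 χ = ⊤ ∨ s = 0) ∧
      (∀ s ∈ S, ∃ s' ∈ S, ∃ m, s + s' = (bidualEval M m, 0)) ∧
      ∃ u ∈ S, p • u = (bidualEval M a, 0) := by
  choose v hv hvtop using fun φ : M →+ ExtCircle => ExtCircle.exists_nsmul_eq hp (φ a)
  have ho : addOrderOf (((1 : ℚ) / p : ℚ) : AddCircle (1 : ℚ)) = p :=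
    AddCircle.addOrderOf_period_div hp
  let u : Bidual M × AddCircle (1 : ℚ) := (v, ((1 : ℚ) / p : ℚ))
  have hu : p • u = (bidualEval M a, 0) := by
    refine Prod.ext (funext hv) ?_
    change p • (((1 : ℚ) / p : ℚ) : AddCircle (1 : ℚ)) = 0
    exact addOrderOf_dvd_iff_nsmul_eq_zero.1 ho.dvd
  have huS : u ∈ AddSubmonoid.closure {u} := AddSubmonoid.subset_closure rfl
  refine ⟨AddSubmonoid.closure {u}, ?_, closure_eq_top_or_eq_zero ?_, closure_exists_add_eq ?_,
    u, huS, hu⟩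
  · intro s hs h0
    obtain ⟨n, rfl⟩ := AddSubmonoid.mem_closure_singleton.1 hs
    obtain ⟨k, rfl⟩ : p ∣ n := ho ▸ addOrderOf_dvd_iff_nsmul_eq_zero.2 h0
    exact ⟨k • a, by rw [mul_nsmul, hu, Prod.smul_mk, map_nsmul]⟩
  · rintro s rfl
    exact hvtop χ ha
  · rintro s rfl
    refine ⟨(p - 1) • u, nsmul_mem huS _, a, ?_⟩
    rw [← succ_nsmul', Nat.sub_add_cancel hp, hu]

theorem exists_refinement_submonoid {χ : M →+ ExtCircle} {a₀ a₁ b₀ b₁ : M} (ha₀ : χ a₀ = ⊤)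
    (ha₁ : χ a₁ = ⊤) (hb₀ : χ b₀ = ⊤) (hb₁ : χ b₁ = ⊤) (h : a₀ + a₁ = b₀ + b₁) :
    ∃ S : AddSubmonoid (Bidual M × ℤ),
      (∀ s ∈ S, s.2 = 0 → ∃ m, s.1 = bidualEval M m) ∧
      (∀ s ∈ S, s.1 χ = ⊤ ∨ s = 0) ∧
      (∀ s ∈ S, ∃ s' ∈ S, ∃ m, s + s' = (bidualEval M m, 0)) ∧
      ∃ c₀₀ ∈ S, ∃ c₀₁ ∈ S, ∃ c₁₀ ∈ S, ∃ c₁₁ ∈ S,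
        c₀₀ + c₀₁ = (bidualEval M a₀, 0) ∧ c₁₀ + c₁₁ = (bidualEval M a₁, 0) ∧
        c₀₀ + c₁₀ = (bidualEval M b₀, 0) ∧ c₀₁ + c₁₁ = (bidualEval M b₁, 0) := by
  choose v₀₀ v₀₁ v₁₀ v₁₁ hv₀ hv₁ hw₀ hw₁ hvtop using fun φ : M →+ ExtCircle =>
    ExtCircle.exists_refinement (φ a₀) (φ a₁) (φ b₀) (φ b₁)
      (by rw [← map_add, h, map_add])
  obtain ⟨t₀₀, t₀₁, t₁₀, t₁₁⟩ := hvtop χ ha₀ ha₁ hb₀ hb₁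
  obtain ⟨c₀₀, hc₀₀⟩ : ∃ c : Bidual M × ℤ, c = (v₀₀, 1) := ⟨_, rfl⟩
  obtain ⟨c₀₁, hc₀₁⟩ : ∃ c : Bidual M × ℤ, c = (v₀₁, -1) := ⟨_, rfl⟩
  obtain ⟨c₁₀, hc₁₀⟩ : ∃ c : Bidual M × ℤ, c = (v₁₀, -1) := ⟨_, rfl⟩
  obtain ⟨c₁₁, hc₁₁⟩ : ∃ c : Bidual M × ℤ, c = (v₁₁, 1) := ⟨_, rfl⟩
  have ea₀ : c₀₀ + c₀₁ = (bidualEval M a₀, 0) := by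
    rw [hc₀₀, hc₀₁]; exact Prod.ext (funext hv₀) rfl
  have ea₁ : c₁₀ + c₁₁ = (bidualEval M a₁, 0) := by
    rw [hc₁₀, hc₁₁]; exact Prod.ext (funext hv₁) rfl
  have eb₀ : c₀₀ + c₁₀ = (bidualEval M b₀, 0) := by
    rw [hc₀₀, hc₁₀]; exact Prod.ext (funext hw₀) rfl
  have eb₁ : c₀₁ + c₁₁ = (bidualEval M b₁, 0) := by
    rw [hc₀₁, hc₁₁]; exact Prod.ext (funext hw₁) rfl
  have hmem : ∀ c ∈ ({c₀₀, c₀₁, c₁₀, c₁₁} : Set (Bidual M × ℤ)),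
      c ∈ AddSubmonoid.closure {c₀₀, c₀₁, c₁₀, c₁₁} := fun c hc => AddSubmonoid.subset_closure hc
  have m₀₀ := hmem c₀₀ (by simp)
  have m₀₁ := hmem c₀₁ (by simp)
  have m₁₀ := hmem c₁₀ (by simp)
  have m₁₁ := hmem c₁₁ (by simp)
  refine ⟨AddSubmonoid.closure {c₀₀, c₀₁, c₁₀, c₁₁}, ?_, closure_eq_top_or_eq_zero ?_,
    closure_exists_add_eq ?_, c₀₀, m₀₀, c₀₁, m₀₁, c₁₀, m₁₀, c₁₁, m₁₁, ea₀, ea₁, eb₀, eb₁⟩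
  · have key : ∀ s ∈ AddSubmonoid.closure {c₀₀, c₀₁, c₁₀, c₁₁},
        ∃ k l m n : ℕ, s = k • c₀₀ + l • c₀₁ + m • c₁₀ + n • c₁₁ := by
      intro s hs
      induction hs using AddSubmonoid.closure_induction with
      | mem s hs =>
        rcases hs with rfl | rfl | rfl | rfl
        · exact ⟨1, 0, 0, 0, by simp⟩
        · exact ⟨0, 1, 0, 0, by simp⟩
        · exact ⟨0, 0, 1, 0, by simp⟩
        · exact ⟨0, 0, 0, 1, by simp⟩
      | zero => exact ⟨0, 0, 0, 0, by simp⟩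
      | add x y _ _ hx hy =>
        obtain ⟨k, l, m, n, rfl⟩ := hx
        obtain ⟨k', l', m', n', rfl⟩ := hy
        exact ⟨k + k', l + l', m + m', n + n', by simp only [add_nsmul]; abel⟩
    intro s hs h0
    obtain ⟨k, l, m, n, rfl⟩ := key s hs
    have hd : (k : ℤ) - l - m + n = 0 := by
      rw [← h0, hc₀₀, hc₀₁, hc₁₀, hc₁₁]
      simp [sub_eq_add_neg]
    obtain ⟨w, x, y, z, rfl, rfl, rfl, rfl⟩ :
        ∃ w x y z : ℕ, k = w + x ∧ l = w + y ∧ m = x + z ∧ n = y + z :=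
      ⟨min k l, k - min k l, l - min k l, n - (l - min k l), by omega, by omega, by omega,
        by omega⟩
    refine ⟨w • a₀ + x • b₀ + y • b₁ + z • a₁, ?_⟩
    have : (w + x) • c₀₀ + (w + y) • c₀₁ + (x + z) • c₁₀ + (y + z) • c₁₁ =
        w • (c₀₀ + c₀₁) + x • (c₀₀ + c₁₀) + y • (c₀₁ + c₁₁) + z • (c₁₀ + c₁₁) := by
      simp only [add_nsmul, nsmul_add]; abel
    rw [this, ea₀, ea₁, eb₀, eb₁]
    simp
  · rintro s (rfl | rfl | rfl | rfl)
    · rwa [hc₀₀]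
    · rwa [hc₀₁]
    · rwa [hc₁₀]
    · rwa [hc₁₁]
  · rintro s (rfl | rfl | rfl | rfl)
    · exact ⟨c₀₁, m₀₁, a₀, ea₀⟩
    · exact ⟨c₀₀, m₀₀, a₀, by rw [add_comm, ea₀]⟩
    · exact ⟨c₁₁, m₁₁, a₁, ea₁⟩
    · exact ⟨c₁₀, m₁₀, a₁, by rw [add_comm, ea₁]⟩

theorem exists_quotient_extension (hM : IsStablyFiniteSepCone M) :
    ∃ (N : Type u) (_ : AddCommMonoid N), IsStablyFiniteSepCone N ∧
      ∃ f : M →+ N, IsUnitary f ∧ ∀ p : ℕ, 0 < p → ∀ a : M, ∃ u : N, p • u = f a := by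
  obtain ⟨χ, hχ⟩ := hM.conical.exists_character_eq_top
  choose S hS₀ hSχ hSc u huS hu using
    fun q : {q : M × ℕ // χ q.1 = ⊤ ∧ 0 < q.2} => exists_quotient_submonoid q.2.1 q.2.2
  obtain ⟨N, _, hN, f, hf, -, g, hg⟩ := exists_graded_extension hM S hχ hS₀ hSχ hSc
  refine ⟨N, inferInstance, hN, f, hf, fun p hp a => ?_⟩
  rcases hχ a with ha | rfl
  · let q : {q : M × ℕ // χ q.1 = ⊤ ∧ 0 < q.2} := ⟨(a, p), ha, hp⟩
    refine ⟨g q ⟨u q, huS q⟩, ?_⟩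
    rw [← map_nsmul]
    exact hg q _ a (hu q)
  · exact ⟨0, by simp⟩

theorem exists_refinement_extension (hM : IsStablyFiniteSepCone M) :
    ∃ (N : Type u) (_ : AddCommMonoid N), IsStablyFiniteSepCone N ∧
      ∃ f : M →+ N, IsStronglyUnitary f ∧ ∀ a₀ a₁ b₀ b₁ : M, a₀ + a₁ = b₀ + b₁ →
        ∃ c₀₀ c₀₁ c₁₀ c₁₁ : N, f a₀ = c₀₀ + c₀₁ ∧ f a₁ = c₁₀ + c₁₁ ∧
          f b₀ = c₀₀ + c₁₀ ∧ f b₁ = c₀₁ + c₁₁ := by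
  obtain ⟨χ, hχ⟩ := hM.conical.exists_character_eq_top
  choose S hS₀ hSχ hSc c₀₀ m₀₀ c₀₁ m₀₁ c₁₀ m₁₀ c₁₁ m₁₁ ea₀ ea₁ eb₀ eb₁ using
    fun q : {q : M × M × M × M // (χ q.1 = ⊤ ∧ χ q.2.1 = ⊤ ∧ χ q.2.2.1 = ⊤ ∧ χ q.2.2.2 = ⊤) ∧
        q.1 + q.2.1 = q.2.2.1 + q.2.2.2} =>
      exists_refinement_submonoid q.2.1.1 q.2.1.2.1 q.2.1.2.2.1 q.2.1.2.2.2 q.2.2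
  obtain ⟨N, _, hN, f, -, hf, g, hg⟩ := exists_graded_extension hM S hχ hS₀ hSχ hSc
  refine ⟨N, inferInstance, hN, f, hf fun m hm a ha => ?_, fun a₀ a₁ b₀ b₁ h => ?_⟩
  · exact (smul_eq_zero.1 ha).resolve_left hm.ne'
  rcases hχ a₀ with ha₀ | rfl
  swap
  · exact ⟨0, 0, f b₀, f b₁, by simp, by rw [← map_add, ← h, zero_add], by simp, by simp⟩
  rcases hχ a₁ with ha₁ | rfl
  swap
  · exact ⟨f b₀, f b₁, 0, 0, by rw [← map_add, ← h, add_zero], by simp, by simp, by simp⟩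
  rcases hχ b₀ with hb₀ | rfl
  swap
  · exact ⟨0, f a₀, 0, f a₁, by simp, by simp, by simp, by rw [← map_add, h, zero_add]⟩
  rcases hχ b₁ with hb₁ | rfl
  swap
  · exact ⟨f a₀, 0, f a₁, 0, by simp, by simp, by rw [← map_add, h, add_zero], by simp⟩
  let q : {q : M × M × M × M // (χ q.1 = ⊤ ∧ χ q.2.1 = ⊤ ∧ χ q.2.2.1 = ⊤ ∧ χ q.2.2.2 = ⊤) ∧
        q.1 + q.2.1 = q.2.2.1 + q.2.2.2} := ⟨(a₀, a₁, b₀, b₁), ⟨ha₀, ha₁, hb₀, hb₁⟩, h⟩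
  refine ⟨g q ⟨_, m₀₀ q⟩, g q ⟨_, m₀₁ q⟩, g q ⟨_, m₁₀ q⟩, g q ⟨_, m₁₁ q⟩, ?_, ?_, ?_, ?_⟩
  · rw [← map_add]; exact (hg q _ a₀ (ea₀ q)).symm
  · rw [← map_add]; exact (hg q _ a₁ (ea₁ q)).symm
  · rw [← map_add]; exact (hg q _ b₀ (eb₀ q)).symm
  · rw [← map_add]; exact (hg q _ b₁ (eb₁ q)).symm

end OneStep

/-! ### Sequential limits -/

theorem IsUnitary.id (M : Type u) [AddCommMonoid M] : IsUnitary (AddMonoidHom.id M) :=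
  ⟨Function.injective_id, fun b => ⟨b, 0, add_zero b⟩, fun _ _ b _ => ⟨b, rfl⟩⟩

theorem IsStronglyUnitary.id (M : Type u) [AddCommMonoid M] :
    IsStronglyUnitary (AddMonoidHom.id M) :=
  ⟨IsUnitary.id M, fun _ _ b _ => ⟨b, rfl⟩⟩

section Comp

variable {A B C : Type u} [AddCommMonoid A] [AddCommMonoid B] [AddCommMonoid C]

theorem IsUnitary.comp {g : B →+ C} {f : A →+ B} (hg : IsUnitary g) (hf : IsUnitary f) :
    IsUnitary (g.comp f) := by
  refine ⟨hg.1.comp hf.1, fun c => ?_, fun a₀ a₁ c h => ?_⟩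
  · obtain ⟨b, x, hx⟩ := hg.2.1 c
    obtain ⟨a, y, hy⟩ := hf.2.1 b
    exact ⟨a, x + g y, by rw [← add_assoc, hx, ← map_add, hy, AddMonoidHom.comp_apply]⟩
  · obtain ⟨b, rfl⟩ := hg.2.2 (f a₀) (f a₁) c h
    rw [AddMonoidHom.comp_apply, AddMonoidHom.comp_apply, ← map_add] at h
    obtain ⟨a, rfl⟩ := hf.2.2 a₀ a₁ b (hg.1 h)
    exact ⟨a, rfl⟩

theorem IsStronglyUnitary.comp {g : B →+ C} {f : A →+ B} (hg : IsStronglyUnitary g)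
    (hf : IsStronglyUnitary f) : IsStronglyUnitary (g.comp f) := by
  refine ⟨hg.1.comp hf.1, fun m hm c hc => ?_⟩
  obtain ⟨a, ha⟩ := hc
  obtain ⟨b, rfl⟩ := hg.2 m hm c ⟨f a, ha⟩
  rw [AddMonoidHom.comp_apply, ← map_nsmul] at ha
  obtain ⟨a', rfl⟩ := hf.2 m hm b ⟨a, hg.1.1 ha⟩
  exact ⟨a', rfl⟩

end Comp

section SequentialLimit

variable {X : ℕ → Type u} [∀ n, AddCommMonoid (X n)]

/-- The composite transition maps of a sequence of homomorphisms. -/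
def transitionHom (f : ∀ n, X n →+ X (n + 1)) (i j : ℕ) (h : i ≤ j) : X i →+ X j :=
  Nat.leRec (motive := fun j _ => X i →+ X j) (AddMonoidHom.id _)
    (fun k _ g => (f k).comp g) h

theorem transitionHom_self (f : ∀ n, X n →+ X (n + 1)) (i : ℕ) (x : X i) :
    transitionHom f i i le_rfl x = x := by
  simp [transitionHom]

theorem transitionHom_succ (f : ∀ n, X n →+ X (n + 1)) {i j : ℕ} (h : i ≤ j) (x : X i) :
    transitionHom f i (j + 1) (h.trans j.le_succ) x = f j (transitionHom f i j h x) := by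
  simp [transitionHom, Nat.leRec_succ _ _ h]

theorem transitionHom_trans (f : ∀ n, X n →+ X (n + 1)) {i j k : ℕ} (hij : i ≤ j) (hjk : j ≤ k)
    (x : X i) :
    transitionHom f j k hjk (transitionHom f i j hij x) =
      transitionHom f i k (hij.trans hjk) x := by
  induction k, hjk using Nat.le_induction with
  | base => rw [transitionHom_self]
  | succ k hjk ih => rw [transitionHom_succ f hjk, ih, transitionHom_succ f (hij.trans hjk)]

theorem transitionHom_injective {f : ∀ n, X n →+ X (n + 1)}
    (hf : ∀ n, Function.Injective (f n)) {i j : ℕ} (h : i ≤ j) :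
    Function.Injective (transitionHom f i j h) := by
  induction j, h using Nat.le_induction with
  | base => exact fun x y hxy => by rwa [transitionHom_self, transitionHom_self] at hxy
  | succ j h ih =>
    intro x y hxy
    rw [transitionHom_succ f h, transitionHom_succ f h] at hxy
    exact ih (hf j hxy)

/-- A sequence of injective homomorphisms has a limit which is the union of its terms. -/
theorem exists_sequential_limit (f : ∀ n, X n →+ X (n + 1))
    (hf : ∀ n, Function.Injective (f n)) :
    ∃ (L : Type u) (_ : AddCommMonoid L) (g : ∀ n, X n →+ L),
      (∀ n, Function.Injective (g n)) ∧ (∀ n x, g (n + 1) (f n x) = g n x) ∧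
      ∀ z w : L, ∃ n x y, g n x = z ∧ g n y = w := by
  have : DirectedSystem X (fun i j h => transitionHom f i j h) :=
    ⟨fun i x => transitionHom_self f i x, fun k j i hij hjk x => transitionHom_trans f hij hjk x⟩
  refine ⟨DirectLimit X (transitionHom f), inferInstance, fun n =>
    { toFun := fun x => ⟦⟨n, x⟩⟧
      map_zero' := (DirectLimit.zero_def n).symm
      map_add' := fun x y => (DirectLimit.add_def n x y).symm }, ?_, ?_, ?_⟩
  · exact DirectLimit.mk_injective _ fun i j h => transitionHom_injective hf h
  · intro n x
    have h := DirectLimit.mk_apply (f := transitionHom f) n (n + 1) x n.le_succ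
    rw [transitionHom_succ f le_rfl, transitionHom_self] at h
    exact h
  · intro z w
    obtain ⟨n, x, y, rfl, rfl⟩ := DirectLimit.exists_eq_mk₂ _ z w
    exact ⟨n, x, y, rfl, rfl⟩

end SequentialLimit

/-! ### The embedding theorem -/

/-- A homomorphism along which all sums can be refined. -/
def RefinesAlong {M N : Type u} [AddCommMonoid M] [AddCommMonoid N] (f : M →+ N) : Prop :=
  ∀ a₀ a₁ b₀ b₁ : M, a₀ + a₁ = b₀ + b₁ → ∃ c₀₀ c₀₁ c₁₀ c₁₁ : N,
    f a₀ = c₀₀ + c₀₁ ∧ f a₁ = c₁₀ + c₁₁ ∧ f b₀ = c₀₀ + c₁₀ ∧ f b₁ = c₀₁ + c₁₁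

/-- A homomorphism along which all elements become divisible. -/
def DividesAlong {M N : Type u} [AddCommMonoid M] [AddCommMonoid N] (f : M →+ N) : Prop :=
  ∀ p : ℕ, 0 < p → ∀ a : M, ∃ u : N, p • u = f a

/-- A bundled stably finite separative cone. -/
structure StablyFiniteSepCone where
  carrier : Type u
  [inst : AddCommMonoid carrier]
  isCone : IsStablyFiniteSepCone carrier

attribute [instance] StablyFiniteSepCone.inst

theorem exists_refinement_quotient_extension (D : Prop) (M : StablyFiniteSepCone.{u}) :
    ∃ (N : StablyFiniteSepCone.{u}) (f : M.carrier →+ N.carrier), IsUnitary f ∧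
      (¬ D → IsStronglyUnitary f) ∧ RefinesAlong f ∧ (D → DividesAlong f) := by
  by_cases hD : D
  · obtain ⟨N, _, hN, f, hf, hdiv⟩ := exists_quotient_extension M.isCone
    obtain ⟨P, _, hP, g, hg, href⟩ := exists_refinement_extension hN
    refine ⟨⟨P, hP⟩, g.comp f, hg.1.comp hf, fun h => absurd hD h, ?_, fun _ p hp a => ?_⟩
    · exact fun a₀ a₁ b₀ b₁ h => href _ _ _ _ (by rw [← map_add, h, map_add])
    · obtain ⟨u, hu⟩ := hdiv p hp a
      exact ⟨g u, by rw [← map_nsmul, hu]; rfl⟩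
  · obtain ⟨N, _, hN, f, hf, href⟩ := exists_refinement_extension M.isCone
    exact ⟨⟨N, hN⟩, f, hf.1, fun _ => hf, href, fun h => absurd h hD⟩

theorem exists_refinement_closure (D : Prop) (M : StablyFiniteSepCone.{u}) :
    ∃ (N : Type u) (_ : AddCommMonoid N), IsStablyFiniteSepCone N ∧ IsRefinementMonoid N ∧
      (D → ∀ p : ℕ, 0 < p → ∀ a : N, ∃ u, p • u = a) ∧
      ∃ f : M.carrier →+ N, IsUnitary f ∧ (¬ D → IsStronglyUnitary f) := by
  choose next incl hunit hstrong href hdiv using exists_refinement_quotient_extension.{u} D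
  let X : ℕ → StablyFiniteSepCone.{u} := fun n => next^[n] M
  have hX : ∀ n, X (n + 1) = next (X n) := fun n => Function.iterate_succ_apply' next n M
  obtain ⟨f, hfu, hfs, hfr, hfd⟩ : ∃ f : ∀ n, (X n).carrier →+ (X (n + 1)).carrier,
      (∀ n, IsUnitary (f n)) ∧ (∀ n, ¬ D → IsStronglyUnitary (f n)) ∧
      (∀ n, RefinesAlong (f n)) ∧ (∀ n, D → DividesAlong (f n)) := by
    have : ∀ n, ∃ f : (X n).carrier →+ (X (n + 1)).carrier, IsUnitary f ∧
        (¬ D → IsStronglyUnitary f) ∧ RefinesAlong f ∧ (D → DividesAlong f) := by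
      intro n
      rw [hX n]
      exact ⟨incl _, hunit _, hstrong _, href _, hdiv _⟩
    choose f hf using this
    exact ⟨f, fun n => (hf n).1, fun n => (hf n).2.1, fun n => (hf n).2.2.1,
      fun n => (hf n).2.2.2⟩
  obtain ⟨L, _, g, hg, hgf, hgs⟩ := exists_sequential_limit f fun n => (hfu n).1
  have hh : ∀ n, ∃ h : (X 0).carrier →+ (X n).carrier,
      IsUnitary h ∧ (¬ D → IsStronglyUnitary h) ∧
      ∀ x, g n (h x) = g 0 x := by
    intro n
    induction n with
    | zero => exact ⟨AddMonoidHom.id _, IsUnitary.id _, fun _ => IsStronglyUnitary.id _,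
        fun _ => rfl⟩
    | succ n ih =>
      obtain ⟨h, h1, h2, h3⟩ := ih
      exact ⟨(f n).comp h, (hfu n).comp h1, fun hD => (hfs n hD).comp (h2 hD),
        fun x => by rw [AddMonoidHom.comp_apply, hgf, h3]⟩
  have hlift : ∀ n (x : (X n).carrier) m, ∃ y, g (n + m) y = g n x := by
    intro n x m
    induction m with
    | zero => exact ⟨x, rfl⟩
    | succ m ih =>
      obtain ⟨y, hy⟩ := ih
      exact ⟨f (n + m) y, by rw [← hy]; exact hgf (n + m) y⟩
  have hlift' : ∀ {n k : ℕ}, n ≤ k → ∀ x : (X n).carrier, ∃ y, g k y = g n x := by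
    intro n k hnk x
    obtain ⟨m, rfl⟩ := Nat.exists_eq_add_of_le hnk
    exact hlift n x m
  have hu : IsUnitary (g 0) := by
    refine ⟨hg 0, fun b => ?_, fun a₀ a₁ b hb => ?_⟩
    · obtain ⟨n, x, -, rfl, -⟩ := hgs b b
      obtain ⟨h, h1, -, h3⟩ := hh n
      obtain ⟨a, y, hy⟩ := h1.2.1 x
      exact ⟨a, g n y, by rw [← map_add, hy, h3]⟩
    · obtain ⟨n, x, -, rfl, -⟩ := hgs b b
      obtain ⟨h, h1, -, h3⟩ := hh n
      rw [← h3, ← h3, ← map_add] at hb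
      obtain ⟨a, rfl⟩ := h1.2.2 a₀ a₁ x (hg n hb)
      exact ⟨a, (h3 a).symm⟩
  have hs : ¬ D → IsStronglyUnitary (g 0) := by
    refine fun hD => ⟨hu, fun m hm b hb => ?_⟩
    obtain ⟨n, x, -, rfl, -⟩ := hgs b b
    obtain ⟨h, -, h2, h3⟩ := hh n
    obtain ⟨a, ha⟩ := hb
    rw [← h3, ← map_nsmul] at ha
    obtain ⟨a', rfl⟩ := (h2 hD).2 m hm x ⟨a, hg n ha⟩
    exact ⟨a', (h3 a').symm⟩
  refine ⟨L, inferInstance, ⟨?_, ?_, ?_⟩, ?_, ?_, g 0, hu, hs⟩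
  · intro x y hxy
    obtain ⟨n, x, y, rfl, rfl⟩ := hgs x y
    rw [← map_add, ← map_zero (g n)] at hxy
    obtain ⟨rfl, rfl⟩ := (X n).isCone.conical x y (hg n hxy)
    exact ⟨map_zero _, map_zero _⟩
  · intro x y hxy
    obtain ⟨n, x, y, rfl, rfl⟩ := hgs x y
    rw [← map_add] at hxy
    rw [(X n).isCone.stablyFinite x y (hg n hxy), map_zero]
  · intro x y h₁ h₂
    obtain ⟨n, x, y, rfl, rfl⟩ := hgs x y
    rw [← map_add, ← map_nsmul] at h₁ h₂
    rw [(X n).isCone.separative x y (hg n h₁) (hg n h₂)]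
  · intro a₀ a₁ b₀ b₁ h
    obtain ⟨n, x₀, x₁, rfl, rfl⟩ := hgs a₀ a₁
    obtain ⟨m, y₀, y₁, rfl, rfl⟩ := hgs b₀ b₁
    obtain ⟨x₀', hx₀⟩ := hlift' (le_max_left n m) x₀
    obtain ⟨x₁', hx₁⟩ := hlift' (le_max_left n m) x₁
    obtain ⟨y₀', hy₀⟩ := hlift' (le_max_right n m) y₀
    obtain ⟨y₁', hy₁⟩ := hlift' (le_max_right n m) y₁
    rw [← hx₀, ← hx₁, ← hy₀, ← hy₁, ← map_add, ← map_add] at h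
    obtain ⟨c₀₀, c₀₁, c₁₀, c₁₁, h₁, h₂, h₃, h₄⟩ := hfr _ _ _ _ _ (hg _ h)
    refine ⟨g _ c₀₀, g _ c₀₁, g _ c₁₀, g _ c₁₁, ?_, ?_, ?_, ?_⟩
    · rw [← map_add, ← h₁, hgf, hx₀]
    · rw [← map_add, ← h₂, hgf, hx₁]
    · rw [← map_add, ← h₃, hgf, hy₀]
    · rw [← map_add, ← h₄, hgf, hy₁]
  · intro hD p hp a
    obtain ⟨n, x, -, rfl, -⟩ := hgs a a
    obtain ⟨u, hu⟩ := hfd n hD p hp x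
    exact ⟨g (n + 1) u, by rw [← map_nsmul, hu, hgf]⟩

/-- Every stably finite separative cone admits a unitary embedding into a
normally divisible stably finite separative refinement cone, and also a strongly unitary
embedding into a stably finite separative refinement cone. -/
theorem stablyFinite_separative_cone_embeddings
    (M : Type u) [AddCommMonoid M] (hM : IsConical M)
    (hsf : IsStablyFinite M) (hsep : IsSeparative M) :
    (∃ (N : Type u) (_ : AddCommMonoid N),
      IsConical N ∧ IsStablyFinite N ∧ IsSeparative N ∧
      IsNormallyDivisible N ∧ IsRefinementMonoid N ∧
      ∃ f : M →+ N, IsUnitary f) ∧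
    (∃ (N : Type u) (_ : AddCommMonoid N),
      IsConical N ∧ IsStablyFinite N ∧ IsSeparative N ∧ IsRefinementMonoid N ∧
      ∃ f : M →+ N, IsStronglyUnitary f) := by
  have hcone : IsStablyFiniteSepCone M := ⟨hM, hsf, hsep⟩
  constructor
  · obtain ⟨N, _, hN, hr, hd, f, hf, -⟩ := exists_refinement_closure True ⟨M, hcone⟩
    exact ⟨N, inferInstance, hN.conical, hN.stablyFinite, hN.separative,
      hN.separative.isNormallyDivisible (hd trivial), hr, f, hf⟩
  · obtain ⟨N, _, hN, hr, -, f, -, hf⟩ := exists_refinement_closure False ⟨M, hcone⟩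
    exact ⟨N, inferInstance, hN.conical, hN.stablyFinite, hN.separative, hr, f, hf not_false⟩
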